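/- arXiv:0902.1917 — 2 statements merged into one kernel-verified Lean document; each statement's English description precedes it below -/
import Mathlib

section
/- Let d ≥ 2 and let e : (0,∞) → (0,∞) satisfy e(r) ≤ r. There exists a nonnegative function f on ℝ^d with ∫ f^{d/(d−1)} dx < ∞ such that for every x with ‖x‖ > 1 and e(‖x‖) ≤ 1/4, the average M_{‖x‖}f(x) of f over the annulus {t : ‖x‖ − e(‖x‖) ≤ ‖t‖ ≤ ‖x‖} translated to x satisfies M_{‖x‖}f(x) ≥ ln|ln e(‖x‖)| / ‖x‖^{d−1}. -/
open MeasureTheory Metric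

/-- The annulus `{t : r - e ≤ ‖t‖ ≤ r}` in `ℝ^d`. -/
def annulus (d : ℕ) (r e : ℝ) : Set (EuclideanSpace ℝ (Fin d)) :=
  {t | r - e ≤ ‖t‖ ∧ ‖t‖ ≤ r}

/-- The average of `f` over the annulus of external radius `r`, thickness `e r`,
translated to `x`. -/
noncomputable def annulusAvg (d : ℕ) (e : ℝ → ℝ) (r : ℝ)
    (f : EuclideanSpace ℝ (Fin d) → ℝ) (x : EuclideanSpace ℝ (Fin d)) : ℝ :=
  (volume (annulus d r (e r))).toReal⁻¹ * ∫ t in annulus d r (e r), f (x + t)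

/-- Radial profile. -/
noncomputable def annGG (n : ℕ) (ρ : ℝ) : ℝ :=
  if ρ ≤ 1 then (ρ ^ n * (1 - Real.log ρ))⁻¹ else 0

lemma annGG_nonneg (n : ℕ) {ρ : ℝ} (h : 0 ≤ ρ) : 0 ≤ annGG n ρ := by
  unfold annGG
  split_ifs with h1
  · have := Real.log_nonpos h h1
    have : 0 ≤ 1 - Real.log ρ := by linarith
    positivity
  · exact le_rfl

lemma annGG_measurable (n : ℕ) : Measurable (annGG n) := by
  unfold annGG
  refine Measurable.ite measurableSet_Iic ?_ measurable_const
  fun_prop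

lemma annGG_lower (n : ℕ) {ρ σ : ℝ} (h0 : 0 < ρ) (h1 : ρ ≤ 1 / 2) (h2 : ρ ≤ σ) (h3 : σ ≤ 2 * ρ) :
    (2 ^ n)⁻¹ * (ρ ^ n * (1 - Real.log ρ))⁻¹ ≤ annGG n σ := by
  unfold annGG
  rw [if_pos (by linarith)]
  have hs : 0 < σ := by linarith
  have l1 : Real.log σ ≤ 0 := Real.log_nonpos hs.le (by linarith)
  have l2 : Real.log ρ ≤ Real.log σ := Real.log_le_log h0 h2
  rw [← mul_inv, ← mul_assoc, ← mul_pow]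
  have : 0 < 1 - Real.log σ := by linarith
  have : 0 < 1 - Real.log ρ := by linarith
  gcongr

lemma annGG_integrable_one (p : ℝ) (hp : 1 < p) :
    IntegrableOn (fun y : ℝ => y⁻¹ * (1 - Real.log y) ^ (-p)) (Set.Ioc 0 1) := by
  set G : ℝ → ℝ := Function.update (fun y => (1 - Real.log y) ^ (1 - p) / (p - 1)) 0 0 with hG
  have key : ∀ x ∈ Set.Ioo (0:ℝ) 1, HasDerivAt G (x⁻¹ * (1 - Real.log x) ^ (-p)) x := by
    intro x hx
    have hl : Real.log x < 0 := Real.log_neg hx.1 hx.2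
    have h1 : HasDerivAt (fun y => 1 - Real.log y) (-x⁻¹) x :=
      (Real.hasDerivAt_log hx.1.ne').const_sub 1
    have h2 := (h1.rpow_const (p := 1 - p) (Or.inl (by linarith))).div_const (p - 1)
    have h3 : HasDerivAt (fun y => (1 - Real.log y) ^ (1 - p) / (p - 1))
        (x⁻¹ * (1 - Real.log x) ^ (-p)) x := by
      convert! h2 using 1
      have : p - 1 ≠ 0 := by linarith
      rw [show 1 - p - 1 = -p by ring]
      field_simp
      ring
    refine h3.congr_of_eventuallyEq ?_
    filter_upwards [lt_mem_nhds hx.1] with y hy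
    simp [hG, Function.update_of_ne hy.ne']
  refine intervalIntegral.integrableOn_deriv_of_nonneg (g := G) ?_ key ?_
  · intro x hx
    rcases hx.1.eq_or_lt with h0 | h0
    · subst h0
      have : ContinuousWithinAt G (Set.Ioi 0) 0 := by
        rw [hG, ContinuousWithinAt]
        rw [Function.update_self]
        have t1 : Filter.Tendsto (fun y : ℝ => 1 - Real.log y) (nhdsWithin 0 (Set.Ioi 0))
            Filter.atTop := by
          have := Filter.tendsto_neg_atBot_atTop.comp Real.tendsto_log_nhdsGT_zero
          exact (Filter.tendsto_atTop_add_const_left _ 1 this).congr (fun y => by simp; ring)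
        have t2 := ((tendsto_rpow_neg_atTop (y := p - 1) (by linarith)).comp t1).div_const (p - 1)
        rw [zero_div] at t2
        refine t2.congr' ?_
        filter_upwards [self_mem_nhdsWithin] with y hy
        simp only [Function.comp]
        rw [Function.update_of_ne (ne_of_gt hy)]
        simp
      refine (continuousWithinAt_insert_self.mpr this).mono ?_
      intro y hy
      rcases hy.1.eq_or_lt with h | h
      · left; exact h.symm
      · right; exact h
    · have hl : Real.log x ≤ 0 := Real.log_nonpos hx.1 hx.2
      have : ContinuousAt (fun y => (1 - Real.log y) ^ (1 - p) / (p - 1)) x := by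
        refine ContinuousAt.div_const (ContinuousAt.rpow_const ?_ (Or.inl (by linarith))) _
        exact continuousAt_const.sub (Real.continuousAt_log h0.ne')
      refine (this.congr ?_).continuousWithinAt
      filter_upwards [lt_mem_nhds h0] with y hy
      simp [hG, Function.update_of_ne hy.ne']
  · intro x hx
    have hl : Real.log x < 0 := Real.log_neg hx.1 hx.2
    have := hx.1
    have : 0 < 1 - Real.log x := by linarith
    positivity

lemma annGG_integrable_rpow (n : ℕ) (hn : 1 ≤ n) :
    Integrable (fun x : EuclideanSpace ℝ (Fin (n + 1)) => annGG n ‖x‖ ^ (((n : ℝ) + 1) / n))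
      volume := by
  rw [integrable_fun_norm_addHaar volume (f := fun y => annGG n y ^ (((n : ℝ) + 1) / n))]
  have hn0 : (0:ℝ) < n := by exact_mod_cast hn
  have h := annGG_integrable_one (((n : ℝ) + 1) / n) (by rw [lt_div_iff₀ hn0]; linarith)
  have h2 : IntegrableOn (fun y : ℝ => y ^ n * annGG n y ^ (((n : ℝ) + 1) / n)) (Set.Ioc 0 1) := by
    refine h.congr_fun ?_ measurableSet_Ioc
    intro y hy
    have hl : Real.log y ≤ 0 := Real.log_nonpos hy.1.le hy.2
    have h1 : 0 < 1 - Real.log y := by linarith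
    have hy0 := hy.1
    simp only [annGG, if_pos hy.2]
    rw [Real.inv_rpow (by positivity), Real.mul_rpow (by positivity) h1.le,
      ← Real.rpow_natCast_mul hy0.le, Real.rpow_neg h1.le]
    rw [mul_div_cancel₀ _ hn0.ne', Real.rpow_add_one hy0.ne', Real.rpow_natCast]
    field_simp
  have h3 := h2.integrable_indicator measurableSet_Ioc
  refine (h3.integrableOn (s := Set.Ioi 0)).congr_fun ?_ measurableSet_Ioi
  intro y hy
  simp only [finrank_euclideanSpace, Fintype.card_fin, Nat.add_sub_cancel, smul_eq_mul]
  by_cases h1 : y ≤ 1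
  · rw [Set.indicator_of_mem (show y ∈ Set.Ioc 0 1 from ⟨hy, h1⟩)]
  · rw [Set.indicator_of_notMem (fun h => h1 h.2)]
    simp only [annGG, if_neg h1]
    rw [Real.zero_rpow (by positivity), mul_zero]

lemma annGG_integrable (n : ℕ) (hn : 1 ≤ n) :
    Integrable (fun x : EuclideanSpace ℝ (Fin (n + 1)) => annGG n ‖x‖) volume := by
  have hn0 : (0:ℝ) < n := by exact_mod_cast hn
  have h1 := annGG_integrable_rpow n hn
  have h2 : Integrable ((closedBall (0 : EuclideanSpace ℝ (Fin (n + 1))) 1).indicator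
      (fun _ => (1:ℝ))) volume :=
    (integrable_indicator_iff measurableSet_closedBall).2
      (integrableOn_const (measure_closedBall_lt_top).ne)
  refine (h1.add h2).mono ((annGG_measurable n).comp measurable_norm).aestronglyMeasurable ?_
  refine Filter.Eventually.of_forall fun x => ?_
  have hg := annGG_nonneg n (norm_nonneg x)
  have hp : 0 ≤ annGG n ‖x‖ ^ (((n : ℝ) + 1) / n) := Real.rpow_nonneg hg _
  have hi : 0 ≤ (closedBall (0 : EuclideanSpace ℝ (Fin (n + 1))) 1).indicator
      (fun _ => (1:ℝ)) x := Set.indicator_nonneg (fun _ _ => zero_le_one) _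
  simp only [Pi.add_apply]
  rw [Real.norm_of_nonneg hg, Real.norm_of_nonneg (add_nonneg hp hi)]
  by_cases hx : ‖x‖ ≤ 1
  · rw [Set.indicator_of_mem (by simpa using hx)]
    rcases le_total (annGG n ‖x‖) 1 with h | h
    · linarith
    · have := Real.rpow_le_rpow_of_exponent_le h (show 1 ≤ ((n : ℝ) + 1) / n by
        rw [le_div_iff₀ hn0]; linarith)
      rw [Real.rpow_one] at this
      linarith
  · have : annGG n ‖x‖ = 0 := by simp [annGG, if_neg hx]
    rw [this] at hp ⊢
    exact add_nonneg hp hi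

lemma ann_volume_le (n : ℕ) {r e : ℝ} (he : 0 < e) (her : e ≤ r) :
    (volume (annulus (n + 1) r e)).toReal ≤
      (n + 1) * r ^ n * e * volume.real (ball (0 : EuclideanSpace ℝ (Fin (n + 1))) 1) := by
  have hsub : annulus (n + 1) r e = closedBall 0 r \ ball 0 (r - e) := by
    ext t; simp [annulus, and_comm]
  have hr : 0 ≤ r := by linarith
  change volume.real _ ≤ _
  have hb : volume.real (ball (0 : EuclideanSpace ℝ (Fin (n + 1))) (r - e)) =
      (r - e) ^ (n + 1) * volume.real (ball (0 : EuclideanSpace ℝ (Fin (n + 1))) 1) := by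
    rw [Measure.real, Measure.addHaar_ball _ _ (by linarith), ENNReal.toReal_mul,
      ENNReal.toReal_ofReal (pow_nonneg (by linarith) _), finrank_euclideanSpace,
      Fintype.card_fin, Measure.real]
  rw [hsub, measureReal_sdiff
      (ball_subset_closedBall.trans (closedBall_subset_closedBall (by linarith)))
    measurableSet_ball measure_closedBall_lt_top.ne,
    Measure.addHaar_real_closedBall _ _ hr, hb, finrank_euclideanSpace, Fintype.card_fin,
    ← sub_mul]
  gcongr
  have h := one_add_mul_le_pow (a := -(e / r)) (by
    have : e / r ≤ 1 := (div_le_one (by linarith)).2 her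
    linarith) (n + 1)
  have hr0 : 0 < r := by linarith
  have h2 := mul_le_mul_of_nonneg_left h (pow_nonneg hr (n + 1))
  rw [← mul_pow, show r * (1 + -(e / r)) = r - e by field_simp; ring] at h2
  have h3 : r ^ (n + 1) * (1 + ((n + 1 : ℕ) : ℝ) * -(e / r)) =
    r ^ (n + 1) - (n + 1) * r ^ n * e := by
    push_cast
    field_simp
    ring
  linarith

lemma ann_isometry (n : ℕ) (x : EuclideanSpace ℝ (Fin (n + 1))) :
    ∃ ψ : ℝ × EuclideanSpace ℝ (Fin n) → EuclideanSpace ℝ (Fin (n + 1)),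
      MeasurePreserving ψ ∧ (∀ s w, ‖ψ (s, w)‖ ^ 2 = s ^ 2 + ‖w‖ ^ 2) ∧
      (∀ s w, ‖x + ψ (s, w)‖ ^ 2 = (s - ‖x‖) ^ 2 + ‖w‖ ^ 2) := by
  have hf : Module.finrank ℝ (WithLp 2 (ℝ × EuclideanSpace ℝ (Fin n))) = n + 1 := by
    rw [(WithLp.linearEquiv 2 ℝ (ℝ × EuclideanSpace ℝ (Fin n))).finrank_eq]
    simp [add_comm]
  let b := (stdOrthonormalBasis ℝ (WithLp 2 (ℝ × EuclideanSpace ℝ (Fin n)))).reindex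
    (finCongr hf)
  let z : WithLp 2 (ℝ × EuclideanSpace ℝ (Fin n)) := WithLp.toLp 2 (-‖x‖, 0)
  have hz : ‖z‖ = ‖x‖ := by
    have : ‖z‖ ^ 2 = ‖x‖ ^ 2 := by
      rw [WithLp.prod_norm_sq_eq_of_L2]; simp [z]
    exact (pow_left_inj₀ (norm_nonneg _) (norm_nonneg _) two_ne_zero).1 this
  let R := (Submodule.span ℝ {b.repr z - x})ᗮ.reflection
  let b' := b.map (b.repr.trans (R.trans b.repr.symm)).symm
  have hb' : b'.repr z = x := by
    have : b'.repr z = R (b.repr z) := by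
      simp [b', OrthonormalBasis.map]
    rw [this]
    exact Submodule.reflection_sub (by simp [hz])
  refine ⟨fun p => b'.repr (WithLp.toLp 2 p), ?_, ?_, ?_⟩
  · exact b'.measurePreserving_repr.comp (WithLp.volume_preserving_toLp _ _)
  · intro s w
    simp only [LinearIsometryEquiv.norm_map]
    rw [WithLp.prod_norm_sq_eq_of_L2]; simp
  · intro s w
    have : x + b'.repr (WithLp.toLp 2 (s, w)) = b'.repr (WithLp.toLp 2 (s - ‖x‖, w)) := by
      conv_lhs => rw [← hb', ← map_add]
      simp only [z, ← WithLp.toLp_add]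
      congr 2
      ext <;> simp [sub_eq_neg_add]
    simp only [this, LinearIsometryEquiv.norm_map]
    rw [WithLp.prod_norm_sq_eq_of_L2]; simp

/-- Lower comparison profile. -/
noncomputable def annHH (n : ℕ) (e : ℝ) : ℝ → ℝ :=
  (Set.Icc e (1 / 2)).indicator fun ρ => (2 ^ n)⁻¹ * (ρ ^ n * (1 - Real.log ρ))⁻¹

lemma annHH_nonneg (n : ℕ) {e : ℝ} (he : 0 < e) (ρ : ℝ) : 0 ≤ annHH n e ρ := by
  refine Set.indicator_nonneg (fun ρ h => ?_) ρ
  have h0 : 0 ≤ ρ := he.le.trans h.1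
  have := Real.log_nonpos h0 (by linarith [h.2])
  have : 0 ≤ 1 - Real.log ρ := by linarith
  positivity

lemma annHH_measurable (n : ℕ) (e : ℝ) : Measurable (annHH n e) := by
  unfold annHH
  refine Measurable.indicator ?_ measurableSet_Icc
  fun_prop

lemma annHH_integral (n : ℕ) (hn : 1 ≤ n) {e : ℝ} (he : 0 < e) (he4 : e ≤ 1 / 4) :
    ∫⁻ w : EuclideanSpace ℝ (Fin n), ENNReal.ofReal (annHH n e ‖w‖) =
      ENNReal.ofReal (n * (volume.real (ball (0 : EuclideanSpace ℝ (Fin n)) 1) * ((2 ^ n)⁻¹ *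
        (Real.log (1 - Real.log e) - Real.log (1 + Real.log 2))))) := by
  have hne : Nonempty (Fin n) := ⟨⟨0, hn⟩⟩
  have key : ∀ y : ℝ, y ^ (n - 1) * annHH n e y =
      (Set.Icc e (1 / 2)).indicator (fun y => (2 ^ n)⁻¹ * (y⁻¹ * (1 - Real.log y)⁻¹)) y := by
    intro y
    unfold annHH
    by_cases hy : y ∈ Set.Icc e (1 / 2)
    · rw [Set.indicator_of_mem hy, Set.indicator_of_mem hy]
      have hy0 : 0 < y := he.trans_le hy.1
      obtain ⟨m, rfl⟩ : ∃ m, n = m + 1 := ⟨n - 1, by omega⟩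
      rw [Nat.add_sub_cancel, mul_inv, pow_succ y, mul_inv]
      field_simp
    · rw [Set.indicator_of_notMem hy, Set.indicator_of_notMem hy, mul_zero]
  have hlog : ∀ y ∈ Set.Icc e (1 / 2), 0 < 1 - Real.log y := by
    intro y hy
    have := Real.log_nonpos (he.le.trans hy.1) (by linarith [hy.2])
    linarith
  have hcont : ContinuousOn (fun y : ℝ => (2 ^ n)⁻¹ * (y⁻¹ * (1 - Real.log y)⁻¹))
      (Set.Icc e (1 / 2)) := by
    have h0 : ∀ y ∈ Set.Icc e (1 / 2), y ≠ 0 := fun y hy => (he.trans_le hy.1).ne'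
    refine continuousOn_const.mul ((continuousOn_inv₀.mono h0).mul (ContinuousOn.inv₀ ?_ ?_))
    · exact continuousOn_const.sub (Real.continuousOn_log.mono h0)
    · intro y hy; exact (hlog y hy).ne'
  have hint : Integrable ((Set.Icc e (1 / 2)).indicator
      (fun y : ℝ => (2 ^ n)⁻¹ * (y⁻¹ * (1 - Real.log y)⁻¹))) :=
    (integrable_indicator_iff measurableSet_Icc).2 hcont.integrableOn_Icc
  have hI : Integrable (fun w : EuclideanSpace ℝ (Fin n) => annHH n e ‖w‖) := by
    rw [integrable_fun_norm_addHaar volume (f := annHH n e)]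
    simp only [finrank_euclideanSpace, Fintype.card_fin, smul_eq_mul, key]
    exact hint.integrableOn
  rw [← ofReal_integral_eq_lintegral_ofReal hI
    (Filter.Eventually.of_forall fun w => annHH_nonneg n he _)]
  congr 1
  rw [integral_fun_norm_addHaar volume (annHH n e)]
  simp only [finrank_euclideanSpace, Fintype.card_fin, smul_eq_mul, key, nsmul_eq_mul]
  congr 2
  rw [setIntegral_indicator measurableSet_Icc, Set.inter_eq_right.2
    (show Set.Icc e (1 / 2) ⊆ Set.Ioi 0 from fun y hy => he.trans_le hy.1), integral_Icc_eq_integral_Ioc,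
    ← intervalIntegral.integral_of_le (by linarith)]
  have := intervalIntegral.integral_eq_sub_of_hasDerivAt_of_le (a := e) (b := 1 / 2)
    (f := fun y => -((2 ^ n)⁻¹ * Real.log (1 - Real.log y)))
    (f' := fun y : ℝ => (2 ^ n)⁻¹ * (y⁻¹ * (1 - Real.log y)⁻¹)) (by linarith) ?_ ?_ ?_
  · rw [this]
    rw [show (1 / 2 : ℝ) = 2⁻¹ by norm_num, Real.log_inv, sub_neg_eq_add]
    ring
  · have h0 : ∀ y ∈ Set.Icc e (1 / 2), y ≠ 0 := fun y hy => (he.trans_le hy.1).ne'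
    refine (continuousOn_const.mul (ContinuousOn.log ?_ ?_)).neg
    · exact continuousOn_const.sub (Real.continuousOn_log.mono h0)
    · intro y hy; exact (hlog y hy).ne'
  · intro y hy
    have hy0 : 0 < y := he.trans hy.1
    have h1 := hlog y ⟨hy.1.le, hy.2.le⟩
    have h2 := ((((Real.hasDerivAt_log hy0.ne').const_sub 1).log h1.ne').const_mul
      ((2 ^ n : ℝ)⁻¹)).neg
    convert! h2 using 1
    rw [div_eq_mul_inv]; ring
  · rw [intervalIntegrable_iff_integrableOn_Icc_of_le (by linarith)]
    exact hcont.integrableOn_Icc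

lemma ann_log_ineq {L : ℝ} (hL : 2 * Real.log 2 ≤ L) :
    Real.log L ≤ 3 * (Real.log (1 + L) - Real.log (1 + Real.log 2)) := by
  have h2 : 0 < Real.log 2 := Real.log_pos (by norm_num)
  have h3 : Real.log 2 < 1 := by linarith [Real.log_two_lt_d9]
  have hL0 : 0 < L := by linarith
  have a : Real.log L ≤ Real.log (1 + L) := Real.log_le_log hL0 (by linarith)
  have b : 3 * Real.log (1 + Real.log 2) ≤ 2 * Real.log (1 + L) := by
    have := Real.log_le_log (x := (1 + Real.log 2) ^ 3) (y := (1 + L) ^ 2) (by positivity) (by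
      calc (1 + Real.log 2) ^ 3 ≤ (1 + 2 * Real.log 2) ^ 2 := by
            nlinarith [mul_pos h2 h2, mul_pos (mul_pos h2 h2) (sub_pos.2 h3)]
        _ ≤ (1 + L) ^ 2 := by gcongr)
    rw [Real.log_pow, Real.log_pow] at this
    exact_mod_cast this
  linarith

/-- The geometric core. -/
lemma ann_geom {r e ρ s : ℝ} (hr : 1 < r) (he : 0 < e) (he4 : e ≤ 1 / 4) (h1 : e ≤ ρ)
    (h2 : ρ ≤ 1 / 2) (hs : s ∈ Set.Icc (√(r ^ 2 - ρ ^ 2) - e) √(r ^ 2 - ρ ^ 2)) :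
    ((r - e) ^ 2 ≤ s ^ 2 + ρ ^ 2 ∧ s ^ 2 + ρ ^ 2 ≤ r ^ 2) ∧
    (ρ ^ 2 ≤ (s - r) ^ 2 + ρ ^ 2 ∧ (s - r) ^ 2 + ρ ^ 2 ≤ (2 * ρ) ^ 2) := by
  have hp : 0 < ρ := he.trans_le h1
  set S := √(r ^ 2 - ρ ^ 2)
  have hS : S ^ 2 = r ^ 2 - ρ ^ 2 := Real.sq_sqrt (by nlinarith)
  have hS0 : 0 ≤ S := Real.sqrt_nonneg _
  have hSr : S ≤ r := abs_le_of_sq_le_sq' (by nlinarith) (by linarith) |>.2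
  have hSl : r - ρ / 2 ≤ S := Real.le_sqrt_of_sq_le (by nlinarith)
  obtain ⟨hs1, hs2⟩ := hs
  have hSe : 0 ≤ S - e := by linarith
  refine ⟨⟨?_, ?_⟩, ?_, ?_⟩
  · have : (S - e) ^ 2 ≤ s ^ 2 := by gcongr
    nlinarith
  · have : s ^ 2 ≤ S ^ 2 := by gcongr; linarith
    linarith
  · nlinarith [sq_nonneg (s - r)]
  · have : (r - s) ^ 2 ≤ (3 / 2 * ρ) ^ 2 := by gcongr <;> linarith
    nlinarith

lemma ann_lintegral_lower (n : ℕ) (x : EuclideanSpace ℝ (Fin (n + 1))) {e : ℝ} (hx : 1 < ‖x‖)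
    (he : 0 < e) (he4 : e ≤ 1 / 4) :
    ENNReal.ofReal e * ∫⁻ w : EuclideanSpace ℝ (Fin n), ENNReal.ofReal (annHH n e ‖w‖) ≤
      ∫⁻ t in annulus (n + 1) ‖x‖ e, ENNReal.ofReal (annGG n ‖x + t‖) := by
  have hA : MeasurableSet (annulus (n + 1) ‖x‖ e) :=
    (measurableSet_le measurable_const measurable_norm).inter
      (measurableSet_le measurable_norm measurable_const)
  obtain ⟨ψ, hψ, hn1, hn2⟩ := ann_isometry n x
  have hm : Measurable (fun t : EuclideanSpace ℝ (Fin (n + 1)) =>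
      (annulus (n + 1) ‖x‖ e).indicator (fun t => ENNReal.ofReal (annGG n ‖x + t‖)) t) :=
    ((annGG_measurable n).comp (by fun_prop)).ennreal_ofReal.indicator hA
  rw [← lintegral_indicator hA, ← hψ.lintegral_comp hm, Measure.volume_eq_prod,
    lintegral_prod_symm (fun a => (annulus (n + 1) ‖x‖ e).indicator
      (fun t => ENNReal.ofReal (annGG n ‖x + t‖)) (ψ a)) (hm.comp hψ.measurable).aemeasurable, ← lintegral_const_mul _
      (show Measurable fun w : EuclideanSpace ℝ (Fin n) => ENNReal.ofReal (annHH n e ‖w‖) from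
        ((annHH_measurable n e).comp measurable_norm).ennreal_ofReal)]
  refine lintegral_mono fun w => ?_
  by_cases hw : ‖w‖ ∈ Set.Icc e (1 / 2)
  swap
  · have h0 : annHH n e ‖w‖ = 0 := Set.indicator_of_notMem hw _
    simp [h0]
  set S := √(‖x‖ ^ 2 - ‖w‖ ^ 2)
  have hv : volume (Set.Icc (S - e) S) = ENNReal.ofReal e := by
    rw [Real.volume_Icc]; congr 1; ring
  rw [mul_comm, ← hv, ← setLIntegral_const, ← lintegral_indicator measurableSet_Icc]
  refine lintegral_mono fun s => ?_
  by_cases hs : s ∈ Set.Icc (S - e) S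
  swap
  · simp [Set.indicator_of_notMem hs]
  rw [Set.indicator_of_mem hs]
  obtain ⟨⟨g1, g2⟩, g3, g4⟩ := ann_geom hx he he4 hw.1 hw.2 hs
  rw [← hn1] at g1 g2
  rw [← hn2] at g3 g4
  have hmem : ψ (s, w) ∈ annulus (n + 1) ‖x‖ e :=
    ⟨(pow_le_pow_iff_left₀ (by linarith) (norm_nonneg _) two_ne_zero).1 g1,
      (pow_le_pow_iff_left₀ (norm_nonneg _) (norm_nonneg _) two_ne_zero).1 g2⟩
  rw [Set.indicator_of_mem hmem]
  refine ENNReal.ofReal_le_ofReal ?_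
  rw [annHH, Set.indicator_of_mem hw]
  exact annGG_lower n (he.trans_le hw.1) hw.2
    ((pow_le_pow_iff_left₀ (norm_nonneg _) (norm_nonneg _) two_ne_zero).1 g3)
    ((pow_le_pow_iff_left₀ (norm_nonneg _) (by positivity) two_ne_zero).1 g4)

theorem averages_on_annuli_stmt6 (d : ℕ) (hd : 2 ≤ d)
    (e : ℝ → ℝ) (hpos : ∀ r > 0, 0 < e r) (hle : ∀ r > 0, e r ≤ r) :
    ∃ f : EuclideanSpace ℝ (Fin d) → ℝ,
      (∀ x, 0 ≤ f x) ∧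
      Integrable (fun x => f x ^ ((d : ℝ) / ((d : ℝ) - 1))) volume ∧
      ∀ x : EuclideanSpace ℝ (Fin d), 1 < ‖x‖ → e ‖x‖ ≤ 1 / 4 →
        Real.log |Real.log (e ‖x‖)| / ‖x‖ ^ (d - 1) ≤ annulusAvg d e ‖x‖ f x := by
  obtain ⟨n, rfl⟩ : ∃ n, d = n + 1 := ⟨d - 1, by omega⟩
  have hn : 1 ≤ n := by omega
  have hn0 : (0:ℝ) < n := by exact_mod_cast hn
  set V := volume.real (ball (0 : EuclideanSpace ℝ (Fin (n + 1))) 1) with hV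
  set W := volume.real (ball (0 : EuclideanSpace ℝ (Fin n)) 1) with hW
  have hVp : 0 < V := ENNReal.toReal_pos (measure_ball_pos _ _ one_pos).ne' measure_ball_lt_top.ne
  have hWp : 0 < W := ENNReal.toReal_pos (measure_ball_pos _ _ one_pos).ne' measure_ball_lt_top.ne
  set K : ℝ := 3 * 2 ^ n * (n + 1) * V / (n * W) with hK
  have hKp : 0 < K := by positivity
  refine ⟨fun y => K * annGG n ‖y‖, fun y => mul_nonneg hKp.le (annGG_nonneg n (norm_nonneg _)),
    ?_, ?_⟩
  · have h := (annGG_integrable_rpow n hn).const_mul (K ^ (((n : ℝ) + 1) / n))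
    refine h.congr (Filter.Eventually.of_forall fun y => ?_)
    simp only [Nat.cast_add, Nat.cast_one, add_sub_cancel_right]
    rw [Real.mul_rpow hKp.le (annGG_nonneg n (norm_nonneg _))]
  · intro x hx he4
    have hr0 : 0 < ‖x‖ := by linarith
    have he := hpos _ hr0
    have her := hle _ hr0
    set ε := e ‖x‖ with hε
    set L := -Real.log ε with hLdef
    have hL : 2 * Real.log 2 ≤ L := by
      have := Real.log_le_log he he4
      rw [show (1 / 4 : ℝ) = (2 ^ 2)⁻¹ by norm_num, Real.log_inv, Real.log_pow] at this
      push_cast at this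
      linarith
    have h2 : 0 < Real.log 2 := Real.log_pos (by norm_num)
    have habs : |Real.log ε| = L := by rw [abs_of_neg (by linarith)]
    have hlog := ann_log_ineq hL
    set J := Real.log (1 + L) - Real.log (1 + Real.log 2) with hJ
    have hJ0 : 0 ≤ J := sub_nonneg.2 (Real.log_le_log (by linarith) (by linarith))
    have hlow := ann_lintegral_lower n x hx he he4
    rw [annHH_integral n hn he he4, ← ENNReal.ofReal_mul he.le] at hlow
    have hI : Integrable (fun t => annGG n ‖x + t‖)
        (volume.restrict (annulus (n + 1) ‖x‖ ε)) :=
      ((annGG_integrable n hn).comp_add_left x).restrict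
    rw [← ofReal_integral_eq_lintegral_ofReal hI
      (Filter.Eventually.of_forall fun t => annGG_nonneg n (norm_nonneg _)),
      ENNReal.ofReal_le_ofReal_iff
        (integral_nonneg fun t => annGG_nonneg n (norm_nonneg _)),
      show 1 - Real.log ε = 1 + L by rw [hLdef]; ring, ← hJ, ← hW] at hlow
    have hvol := ann_volume_le n he her
    rw [← hV] at hvol
    have hIpos : ∀ J' : ℝ, 0 ≤ J' → 0 ≤ K * (ε * (n * (W * ((2 ^ n)⁻¹ * J')))) := by
      intro J' _; positivity
    unfold annulusAvg
    rw [← hε, integral_const_mul, habs, Nat.add_sub_cancel]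
    have hKI := mul_le_mul_of_nonneg_left hlow hKp.le
    have hKe : K * (ε * (n * (W * ((2 ^ n)⁻¹ * J)))) = (n + 1) * ε * V * (3 * J) := by
      rw [hK]; field_simp
    rw [hKe] at hKI
    have hvpos : 0 < (volume (annulus (n + 1) ‖x‖ ε)).toReal := by
      refine ENNReal.toReal_pos (fun h0 => ?_) ?_
      · rw [Measure.restrict_eq_zero.2 h0, integral_zero_measure, mul_zero] at hKI
        have hJ1 : 0 < J := sub_pos.2 (Real.log_lt_log (by linarith) (by linarith))
        have : 0 < (n + 1) * ε * V * (3 * J) := by positivity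
        linarith
      · refine ((measure_mono ?_).trans_lt
          (measure_closedBall_lt_top (x := (0 : EuclideanSpace ℝ (Fin (n + 1))))
            (r := ‖x‖))).ne
        intro t ht
        simpa using ht.2
    rw [inv_mul_eq_div, div_le_div_iff₀ (by positivity) hvpos]
    calc Real.log L * (volume (annulus (n + 1) ‖x‖ ε)).toReal
        ≤ (3 * J) * ((n + 1) * ‖x‖ ^ n * ε * V) := by
          gcongr
      _ = ((n + 1) * ε * V * (3 * J)) * ‖x‖ ^ n := by ring
      _ ≤ _ := by gcongr
end

section
/- Let d ≥ 2 and suppose the thickness function e satisfies: for some a > 1, for every δ > 0 there exists h > 0 with e(r) ≤ δr for all r ∈ [h, ah]. Then there is no constant C such that for all nonnegative g ∈ L^{d/(d−1)}(ℝ^d), |{x ∈ ℝ^d : sup_{r>0} M_r g(x) > 1}| ≤ C ∫ g^{d/(d−1)} dx. That is, the family (M_r)_{r>0} does not satisfy the weak-L^{d/(d−1)} maximal inequality. -/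
open MeasureTheory Metric Set

lemma annulus_meas (d : ℕ) (r e : ℝ) : MeasurableSet (annulus d r e) := by
  have : annulus d r e = (fun t : EuclideanSpace ℝ (Fin d) => ‖t‖) ⁻¹' Icc (r - e) r := by
    ext t; simp [annulus]
  rw [this]
  exact measurable_norm measurableSet_Icc

lemma annulus_finite (d : ℕ) (r e : ℝ) : volume (annulus d r e) < ⊤ := by
  refine lt_of_le_of_lt (measure_mono (t := closedBall 0 r) ?_) measure_closedBall_lt_top
  intro t ht
  simpa using ht.2

lemma annulus_pos (d : ℕ) (r e : ℝ) (hr : 0 < r) (he : 0 < e) (her : e ≤ r)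
    (p : EuclideanSpace ℝ (Fin d)) (hp : ‖p‖ = r) : 0 < volume (annulus d r e) := by
  have ho : IsOpen ((fun t : EuclideanSpace ℝ (Fin d) => ‖t‖) ⁻¹' Ioo (r - e) r) :=
    isOpen_Ioo.preimage continuous_norm
  refine lt_of_lt_of_le (ho.measure_pos volume ?_) (measure_mono ?_)
  · refine ⟨((r - e / 2) / r) • p, ?_⟩
    have h1 : ‖((r - e / 2) / r) • p‖ = r - e / 2 := by
      rw [norm_smul, hp, Real.norm_eq_abs, abs_of_nonneg (div_nonneg (by linarith) hr.le)]
      field_simp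
    simp only [mem_preimage, h1, mem_Ioo]
    constructor <;> linarith
  · intro t ht
    exact ⟨ht.1.le, ht.2.le⟩

/-- rotation invariance -/
lemma rot_inv (d : ℕ) (r e R : ℝ) (p q : EuclideanSpace ℝ (Fin d)) (h : ‖p‖ = ‖q‖) :
    volume (annulus d r e ∩ closedBall p R) = volume (annulus d r e ∩ closedBall q R) := by
  let f := (ℝ ∙ (p - q))ᗮ.reflection
  have hf : f p = q := Submodule.reflection_sub h
  have hmp : MeasurePreserving f volume volume := f.measurePreserving
  rw [← hmp.measure_preimage (s := annulus d r e ∩ closedBall q R)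
    ((annulus_meas d r e).inter measurableSet_closedBall).nullMeasurableSet]
  congr 1
  ext t
  simp only [mem_inter_iff, mem_preimage, annulus, mem_ofPred_eq, mem_closedBall, ← hf,
    LinearIsometryEquiv.norm_map, LinearIsometryEquiv.dist_map]

lemma fubini_bound (d : ℕ) (r e ρ : ℝ) (hr : 0 < r) (he : e ≤ ρ) (hρ : 0 < ρ)
    (p : EuclideanSpace ℝ (Fin d)) (hp : ‖p‖ = r) :
    volume (annulus d r e) * volume (ball (0 : EuclideanSpace ℝ (Fin d)) ρ) ≤
      volume (annulus d (r + ρ) (3 * ρ)) * volume (annulus d r e ∩ closedBall p (3 * ρ)) := by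
  let E := EuclideanSpace ℝ (Fin d)
  let S : Set (E × E) := {z | z.2 ∈ annulus d r e ∧ dist z.1 z.2 < ρ}
  have hS : MeasurableSet S :=
    (measurable_snd (annulus_meas d r e)).inter
      (measurableSet_lt (measurable_dist) measurable_const)
  have h1 : (volume.prod volume : Measure (E × E)) S =
      volume (annulus d r e) * volume (ball (0 : E) ρ) := by
    rw [Measure.prod_apply_symm hS]
    have : ∀ t : E, volume ((fun s : E => (s, t)) ⁻¹' S) =
        (annulus d r e).indicator (fun _ => volume (ball (0 : E) ρ)) t := by
      intro t
      by_cases ht : t ∈ annulus d r e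
      · rw [indicator_of_mem ht]
        have : (fun s : E => (s, t)) ⁻¹' S = ball t ρ := by
          ext s; simp [S, ht]
        rw [this, Measure.addHaar_ball_center]
      · rw [indicator_of_notMem ht]
        have : (fun s : E => (s, t)) ⁻¹' S = ∅ := by
          ext s; simp [S, ht]
        rw [this, measure_empty]
    simp_rw [this]
    rw [lintegral_indicator_const (annulus_meas d r e), mul_comm]
  rw [← h1, Measure.prod_apply hS]
  have h2 : ∀ s : E, volume (Prod.mk s ⁻¹' S) ≤
      (annulus d (r + ρ) (3 * ρ)).indicator
        (fun _ => volume (annulus d r e ∩ closedBall p (3 * ρ))) s := by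
    intro s
    by_cases hs : s ∈ annulus d (r + ρ) (3 * ρ)
    · rw [indicator_of_mem hs]
      obtain ⟨hs1, hs2⟩ := hs
      have : ∃ q : E, ‖q‖ = r ∧ dist s q ≤ 2 * ρ := by
        by_cases h0 : s = 0
        · refine ⟨p, hp, ?_⟩
          subst h0
          rw [dist_zero_left, hp]
          rw [norm_zero] at hs1
          linarith
        · have hn : 0 < ‖s‖ := norm_pos_iff.2 h0
          refine ⟨(r / ‖s‖) • s, ?_, ?_⟩
          · rw [norm_smul, Real.norm_eq_abs, abs_of_pos (by positivity)]
            field_simp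
          · have : s - (r / ‖s‖) • s = (1 - r / ‖s‖) • s := by
              rw [sub_smul, one_smul]
            rw [dist_eq_norm, this, norm_smul, Real.norm_eq_abs]
            nth_rewrite 2 [← abs_of_pos hn]
            rw [← abs_mul, sub_mul, div_mul_cancel₀ _ hn.ne', abs_le]
            constructor <;> linarith
      obtain ⟨q, hq, hsq⟩ := this
      rw [rot_inv d r e (3 * ρ) p q (hp.trans hq.symm)]
      apply measure_mono
      intro t ht
      refine ⟨ht.1, ?_⟩
      have h3 : dist s t < ρ := ht.2
      rw [mem_closedBall]
      have := dist_triangle_left t q s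
      linarith
    · rw [indicator_of_notMem hs]
      have : Prod.mk s ⁻¹' S = ∅ := by
        rw [eq_empty_iff_forall_notMem]
        intro t ht
        apply hs
        have h3 : dist s t < ρ := ht.2
        obtain ⟨h4, h5⟩ : t ∈ annulus d r e := ht.1
        rw [dist_eq_norm] at h3
        have h6 := abs_le.1 (abs_norm_sub_norm_le s t)
        constructor <;> linarith
      rw [this, measure_empty]
  calc _ ≤ _ := lintegral_mono h2
    _ = _ := by
      rw [lintegral_indicator_const (annulus_meas d _ _), mul_comm]

lemma shell_bound (d : ℕ) (hd : 1 ≤ d) (r ρ : ℝ) (hρ : 0 < ρ) (hr : 3 * ρ ≤ r) :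
    volume (annulus d (r + ρ) (3 * ρ)) ≤ ENNReal.ofReal (3 * ρ * d * (2 * r) ^ (d - 1)) *
      volume (ball (0 : EuclideanSpace ℝ (Fin d)) 1) := by
  have : Nontrivial (EuclideanSpace ℝ (Fin d)) := by
    have : Nonempty (Fin d) := ⟨⟨0, hd⟩⟩
    infer_instance
  have h1 : annulus d (r + ρ) (3 * ρ) = closedBall 0 (r + ρ) \ ball 0 (r - 2 * ρ) := by
    ext t
    simp only [annulus, mem_ofPred_eq, mem_sdiff, mem_closedBall, mem_ball, dist_zero_right, not_lt]
    constructor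
    · rintro ⟨h, hb⟩; exact ⟨hb, by linarith⟩
    · rintro ⟨h, hb⟩; exact ⟨by linarith, h⟩
  rw [h1, measure_sdiff ((ball_subset_ball (by linarith)).trans ball_subset_closedBall)
    measurableSet_ball.nullMeasurableSet measure_ball_lt_top.ne,
    Measure.addHaar_closedBall _ _ (by linarith),
    Measure.addHaar_ball _ (0 : EuclideanSpace ℝ (Fin d)) (by linarith : 0 ≤ r - 2 * ρ),
    finrank_euclideanSpace_fin, ← ENNReal.sub_mul (fun _ _ => measure_ball_lt_top.ne),
    ← ENNReal.ofReal_sub _ (pow_nonneg (by linarith) _)]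
  gcongr
  obtain ⟨D, rfl⟩ : ∃ D, d = D + 1 := ⟨d - 1, by omega⟩
  have h2 := (Commute.all (r + ρ) (r - 2 * ρ)).mul_geom_sum₂ (D + 1)
  rw [← h2]
  have h3 : ∑ i ∈ Finset.range (D + 1), (r + ρ) ^ i * (r - 2 * ρ) ^ (D + 1 - 1 - i) ≤
      ∑ i ∈ Finset.range (D + 1), (2 * r) ^ D := by
    apply Finset.sum_le_sum
    intro i hi
    rw [Finset.mem_range] at hi
    have : (2 * r) ^ D = (2 * r) ^ i * (2 * r) ^ (D + 1 - 1 - i) := by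
      rw [← pow_add]; congr 1; omega
    rw [this]
    have : 0 ≤ r - 2 * ρ := by linarith
    have : 0 ≤ r + ρ := by linarith
    have : r + ρ ≤ 2 * r := by linarith
    have : r - 2 * ρ ≤ 2 * r := by linarith
    have : 0 ≤ r := by linarith
    gcongr
  rw [Finset.sum_const, Finset.card_range, nsmul_eq_mul] at h3
  calc _ = 3 * ρ * ∑ i ∈ Finset.range (D + 1), (r + ρ) ^ i * (r - 2 * ρ) ^ (D + 1 - 1 - i) := by
        ring
    _ ≤ 3 * ρ * (((D + 1 : ℕ) : ℝ) * (2 * r) ^ D) := by gcongr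
    _ = _ := by simp only [Nat.add_sub_cancel]; ring

lemma key (d : ℕ) (hd : 1 ≤ d) (r e R : ℝ) (hR : 0 < R) (hRr : R ≤ r) (he : e ≤ R / 3)
    (p : EuclideanSpace ℝ (Fin d)) (hp : ‖p‖ = r) :
    volume.real (annulus d r e) * ((R / r) ^ (d - 1) / (3 * d * 6 ^ (d - 1))) ≤
      volume.real (annulus d r e ∩ closedBall p R) := by
  have : Nontrivial (EuclideanSpace ℝ (Fin d)) := by
    have : Nonempty (Fin d) := ⟨⟨0, hd⟩⟩
    infer_instance
  have hr : 0 < r := by linarith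
  have h1 := fubini_bound d r e (R / 3) hr he (by linarith) p hp
  have h2 := shell_bound d hd r (R / 3) (by linarith) (by linarith)
  have h3 := h1.trans (mul_le_mul_left h2 _)
  rw [show 3 * (R / 3) = R by ring] at h3
  have hv : 0 < volume.real (ball (0 : EuclideanSpace ℝ (Fin d)) 1) :=
    ENNReal.toReal_pos (measure_ball_pos _ _ one_pos).ne' measure_ball_lt_top.ne
  have hfin : volume (annulus d r e ∩ closedBall p R) ≠ ⊤ :=
    (lt_of_le_of_lt (measure_mono inter_subset_left) (annulus_finite d r e)).ne
  have h4 := ENNReal.toReal_mono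
    (ENNReal.mul_ne_top (ENNReal.mul_ne_top ENNReal.ofReal_ne_top measure_ball_lt_top.ne) hfin) h3
  rw [Measure.addHaar_ball _ _ (by linarith : 0 ≤ R / 3), finrank_euclideanSpace_fin] at h4
  simp only [ENNReal.toReal_mul] at h4
  rw [ENNReal.toReal_ofReal (by positivity), ENNReal.toReal_ofReal (by positivity)] at h4
  change volume.real _ * (_ * volume.real _) ≤ _ * volume.real _ * volume.real _ at h4
  obtain ⟨D, rfl⟩ : ∃ D, d = D + 1 := ⟨d - 1, by omega⟩
  simp only [Nat.add_sub_cancel] at h4 ⊢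
  set V := volume.real (annulus (D + 1) r e)
  set W := volume.real (annulus (D + 1) r e ∩ closedBall p R)
  set v := volume.real (ball (0 : EuclideanSpace ℝ (Fin (D + 1))) 1)
  have hDpos : (0 : ℝ) < ((D + 1 : ℕ) : ℝ) := by positivity
  have h5 : V * (R / 3) ^ D ≤ 3 * ((D + 1 : ℕ) : ℝ) * (2 * r) ^ D * W := by
    have : (v * (R / 3)) * (V * (R / 3) ^ D) ≤
        (v * (R / 3)) * (3 * ((D + 1 : ℕ) : ℝ) * (2 * r) ^ D * W) := by
      calc _ = V * ((R / 3) ^ (D + 1) * v) := by ring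
        _ ≤ _ := h4
        _ = _ := by ring
    exact le_of_mul_le_mul_left this (by positivity)
  have h6 : (R / 3) ^ D = (R / r) ^ D / 6 ^ D * (2 * r) ^ D := by
    rw [← div_pow, ← mul_pow]; congr 1; field_simp; norm_num
  rw [h6] at h5
  have h7 : 0 < 3 * ((D + 1 : ℕ) : ℝ) * (2 * r) ^ D := by positivity
  refine le_of_mul_le_mul_left (le_trans (le_of_eq ?_) h5) h7
  field_simp

/-- The test function. -/
noncomputable def testFun (d : ℕ) (h A : ℝ) (n : ℕ) (y : EuclideanSpace ℝ (Fin d)) : ℝ :=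
  A * ∑ k ∈ Finset.range n, (2 : ℝ) ^ (k * (d - 1)) *
    (closedBall (0 : EuclideanSpace ℝ (Fin d)) (h / 2 ^ k)).indicator 1 y

lemma testFun_avg (d : ℕ) (e : ℝ → ℝ) (hd : 1 ≤ d) (a h A : ℝ) (n : ℕ) (hA : 0 ≤ A)
    (hh : 0 < h) (r : ℝ) (hr : h ≤ r) (hra : r ≤ a * h) (he0 : 0 < e r) (her : e r ≤ r)
    (he : e r ≤ h / 2 ^ n / 3)
    (x : EuclideanSpace ℝ (Fin d)) (hx : ‖x‖ = r) :
    A * (n / (a ^ (d - 1) * (3 * d * 6 ^ (d - 1)))) ≤ annulusAvg d e r (testFun d h A n) x := by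
  have hr0 : 0 < r := by linarith
  have hV : 0 < volume.real (annulus d r (e r)) :=
    ENNReal.toReal_pos (annulus_pos d r (e r) hr0 he0 her x hx).ne' (annulus_finite d r _).ne
  have hind : ∀ k : ℕ, ∀ t : EuclideanSpace ℝ (Fin d),
      (closedBall (0 : EuclideanSpace ℝ (Fin d)) (h / 2 ^ k)).indicator (1 : EuclideanSpace ℝ (Fin d) → ℝ) (x + t) =
      (closedBall (-x) (h / 2 ^ k)).indicator (1 : EuclideanSpace ℝ (Fin d) → ℝ) t := by
    intro k t
    simp only [indicator, mem_closedBall, dist_eq_norm, sub_zero, sub_neg_eq_add, add_comm,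
      Pi.one_apply]
  have hintegral : ∫ t in annulus d r (e r), testFun d h A n (x + t) =
      A * ∑ k ∈ Finset.range n, (2 : ℝ) ^ (k * (d - 1)) *
        volume.real (annulus d r (e r) ∩ closedBall (-x) (h / 2 ^ k)) := by
    simp only [testFun, hind]
    rw [integral_const_mul, integral_finsetSum]
    · congr 1
      apply Finset.sum_congr rfl
      intro k _
      rw [integral_const_mul, integral_indicator_one measurableSet_closedBall,
        measureReal_restrict_apply measurableSet_closedBall, inter_comm]
    · intro k _
      apply Integrable.const_mul
      apply (integrable_indicator_iff measurableSet_closedBall).2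
      apply integrableOn_const
      · exact (lt_of_le_of_lt (Measure.restrict_apply_le _ _) measure_closedBall_lt_top).ne
      · simp
  rw [annulusAvg, hintegral]
  have hterm : ∀ k ∈ Finset.range n,
      volume.real (annulus d r (e r)) * (1 / (a ^ (d - 1) * (3 * d * 6 ^ (d - 1)))) ≤
      (2 : ℝ) ^ (k * (d - 1)) *
        volume.real (annulus d r (e r) ∩ closedBall (-x) (h / 2 ^ k)) := by
    intro k hk
    rw [Finset.mem_range] at hk
    have h2 : (1 : ℝ) ≤ 2 ^ k := one_le_pow₀ (by norm_num)
    have hkn : h / 2 ^ n ≤ h / 2 ^ k := by gcongr; norm_num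
    have hk1 : h / 2 ^ k ≤ h := div_le_self hh.le h2
    have := key d hd r (e r) (h / 2 ^ k) (by positivity) (by linarith) (by linarith) (-x)
      (by rw [norm_neg, hx])
    refine le_trans ?_ (mul_le_mul_of_nonneg_left this (by positivity))
    rw [mul_left_comm ((2 : ℝ) ^ (k * (d - 1)))]
    apply mul_le_mul_of_nonneg_left _ hV.le
    have ha : 0 < a := by
      by_contra hcon
      nlinarith
    have hq : 1 / a ≤ 2 ^ k * (h / 2 ^ k / r) := by
      rw [show 2 ^ k * (h / 2 ^ k / r) = h / r by field_simp]
      rw [div_le_div_iff₀ ha hr0]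
      linarith
    calc _ = (1 / a) ^ (d - 1) / (3 * d * 6 ^ (d - 1)) := by
          rw [div_pow, one_pow, div_div]
      _ ≤ (2 ^ k * (h / 2 ^ k / r)) ^ (d - 1) / (3 * d * 6 ^ (d - 1)) := by gcongr
      _ = _ := by rw [mul_pow, ← pow_mul]; ring
  have hsum := Finset.sum_le_sum hterm
  rw [Finset.sum_const, Finset.card_range, nsmul_eq_mul] at hsum
  change _ ≤ (volume.real (annulus d r (e r)))⁻¹ * _
  rw [mul_left_comm (volume.real (annulus d r (e r)))⁻¹]
  apply mul_le_mul_of_nonneg_left _ hA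
  rw [le_inv_mul_iff₀ hV]
  refine le_trans (le_of_eq ?_) hsum
  ring

lemma sum_rpow_bound (D : ℕ) (hD : 1 ≤ D) (p : ℝ) (hp : p = ((D : ℝ) + 1) / D) (w : ℕ → ℝ)
    (hw : ∀ k, w k = 0 ∨ w k = 1) (n : ℕ) :
    (∑ k ∈ Finset.range n, (2 : ℝ) ^ (k * D) * w k) ^ p ≤
      2 ^ p * ∑ k ∈ Finset.range n, (2 : ℝ) ^ (k * (D + 1)) * w k := by
  have hD0 : (0 : ℝ) < D := by exact_mod_cast hD
  have hp0 : 0 < p := by rw [hp]; positivity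
  have hw0 : ∀ k, 0 ≤ w k := fun k => by rcases hw k with h | h <;> simp [h]
  have hw1 : ∀ k, w k ≤ 1 := fun k => by rcases hw k with h | h <;> simp [h]
  induction n with
  | zero => simp [Real.zero_rpow hp0.ne']
  | succ n ih =>
    rcases hw n with h | h
    · rw [Finset.sum_range_succ, Finset.sum_range_succ, h]
      simpa using ih
    · have hgeo : ∀ m : ℕ, ∑ k ∈ Finset.range (m + 1), (2 : ℝ) ^ (k * D) * w k ≤
          2 * 2 ^ (m * D) := by
        intro m
        induction m with
        | zero => simp; linarith [hw1 0]
        | succ m ihm =>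
          rw [Finset.sum_range_succ]
          have h1 : (2 : ℝ) ^ ((m + 1) * D) * w (m + 1) ≤ 2 ^ ((m + 1) * D) :=
            mul_le_of_le_one_right (by positivity) (hw1 _)
          have h2 : (2 : ℝ) * 2 ^ (m * D) ≤ 2 ^ ((m + 1) * D) := by
            rw [← pow_succ']
            apply pow_le_pow_right₀ (by norm_num)
            nlinarith
          linarith
      have hnn : 0 ≤ ∑ k ∈ Finset.range (n + 1), (2 : ℝ) ^ (k * D) * w k :=
        Finset.sum_nonneg fun k _ => mul_nonneg (by positivity) (hw0 k)
      calc _ ≤ ((2 : ℝ) * 2 ^ (n * D)) ^ p := Real.rpow_le_rpow hnn (hgeo n) hp0.le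
        _ = 2 ^ p * (2 ^ (n * (D + 1)) * w n) := by
          rw [Real.mul_rpow (by norm_num) (by positivity), h, mul_one, ← Real.rpow_natCast,
            ← Real.rpow_natCast, ← Real.rpow_mul (by norm_num)]
          congr 2
          rw [hp]; push_cast; field_simp
        _ ≤ _ := by
          apply mul_le_mul_of_nonneg_left _ (by positivity)
          exact Finset.single_le_sum
            (f := fun k => (2 : ℝ) ^ (k * (D + 1)) * w k)
            (fun k _ => mul_nonneg (by positivity) (hw0 k)) (Finset.mem_range.2 (Nat.lt_succ_self n))

lemma testFun_nonneg (d : ℕ) (h A : ℝ) (n : ℕ) (hA : 0 ≤ A) (y : EuclideanSpace ℝ (Fin d)) :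
    0 ≤ testFun d h A n y :=
  mul_nonneg hA (Finset.sum_nonneg fun k _ => mul_nonneg (by positivity)
    (indicator_nonneg (fun _ _ => zero_le_one) _))

lemma testFun_int (D : ℕ) (hD : 1 ≤ D) (p : ℝ) (hp : p = ((D : ℝ) + 1) / D) (h A : ℝ) (n : ℕ)
    (hA : 0 ≤ A) (hh : 0 < h) :
    Integrable (fun y => testFun (D + 1) h A n y ^ p) volume ∧
    ∫ y, testFun (D + 1) h A n y ^ p ≤ (2 * A) ^ p *
      (n * (h ^ (D + 1) * volume.real (ball (0 : EuclideanSpace ℝ (Fin (D + 1))) 1))) := by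
  let G : EuclideanSpace ℝ (Fin (D + 1)) → ℝ := fun y =>
    (2 * A) ^ p * ∑ k ∈ Finset.range n, (2 : ℝ) ^ (k * (D + 1)) *
    (closedBall (0 : EuclideanSpace ℝ (Fin (D + 1))) (h / 2 ^ k)).indicator 1 y
  have hle : ∀ y, testFun (D + 1) h A n y ^ p ≤ G y := by
    intro y
    have := sum_rpow_bound D hD p hp (fun k =>
      (closedBall (0 : EuclideanSpace ℝ (Fin (D + 1))) (h / 2 ^ k)).indicator 1 y)
      (fun k => by
        by_cases hy : y ∈ closedBall (0 : EuclideanSpace ℝ (Fin (D + 1))) (h / 2 ^ k)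
        · right; simp only [indicator_of_mem hy, Pi.one_apply]
        · left; simp only [indicator_of_notMem hy]) n
    simp only [testFun, G, Nat.add_sub_cancel]
    rw [Real.mul_rpow hA (Finset.sum_nonneg fun k _ => mul_nonneg (by positivity)
      (indicator_nonneg (f := 1) (fun _ _ => zero_le_one) _)), Real.mul_rpow (by norm_num) hA,
      mul_comm ((2 : ℝ) ^ p), mul_assoc]
    exact mul_le_mul_of_nonneg_left this (by positivity)
  have hi : ∀ k ∈ Finset.range n, Integrable (fun y => (2 : ℝ) ^ (k * (D + 1)) *
    (closedBall (0 : EuclideanSpace ℝ (Fin (D + 1))) (h / 2 ^ k)).indicator (1 : EuclideanSpace ℝ (Fin (D + 1)) → ℝ) y)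
      volume := by
    intro k _
    apply Integrable.const_mul
    apply (integrable_indicator_iff measurableSet_closedBall).2
    apply integrableOn_const
    · exact measure_closedBall_lt_top.ne
    · simp
  have hG : Integrable G volume := (integrable_finsetSum _ hi).const_mul _
  have hm : Measurable (fun y => testFun (D + 1) h A n y ^ p) := by
    apply Measurable.pow_const
    unfold testFun
    apply Measurable.const_mul
    apply Finset.measurable_fun_sum
    intro k _
    apply Measurable.const_mul
    exact measurable_one.indicator measurableSet_closedBall
  have hI : Integrable (fun y => testFun (D + 1) h A n y ^ p) volume := by
    refine hG.mono' hm.aestronglyMeasurable (Filter.Eventually.of_forall fun y => ?_)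
    rw [Real.norm_eq_abs, abs_of_nonneg (Real.rpow_nonneg (testFun_nonneg _ _ _ _ hA _) _)]
    exact hle y
  refine ⟨hI, (integral_mono hI hG hle).trans (le_of_eq ?_)⟩
  simp only [G]
  rw [integral_const_mul, integral_finsetSum _ hi]
  congr 1
  rw [← nsmul_eq_mul, ← Finset.card_range n, ← Finset.sum_const, Finset.card_range]
  apply Finset.sum_congr rfl
  intro k _
  rw [integral_const_mul, integral_indicator_one measurableSet_closedBall, measureReal_def,
    Measure.addHaar_closedBall _ _ (by positivity), finrank_euclideanSpace_fin,
    ENNReal.toReal_mul, ENNReal.toReal_ofReal (by positivity), ← measureReal_def, div_pow,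
    ← pow_mul, ← mul_assoc]
  congr 1
  field_simp

lemma shell_vol (d : ℕ) (a h : ℝ) (ha : 1 < a) (hh : 0 < h) :
    volume.real (annulus d (a * h) (a * h - h)) =
      (a ^ d - 1) * h ^ d * volume.real (ball (0 : EuclideanSpace ℝ (Fin d)) 1) := by
  have h1 : annulus d (a * h) (a * h - h) = closedBall 0 (a * h) \ ball 0 h := by
    ext t
    simp only [annulus, mem_ofPred_eq, mem_sdiff, mem_closedBall, mem_ball, dist_zero_right, not_lt]
    constructor
    · rintro ⟨h, hb⟩; exact ⟨hb, by linarith⟩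
    · rintro ⟨h, hb⟩; exact ⟨by linarith, h⟩
  have hah : h ≤ a * h := by nlinarith
  rw [h1, measureReal_sdiff ((ball_subset_ball hah).trans ball_subset_closedBall)
    measurableSet_ball measure_closedBall_lt_top.ne]
  simp only [measureReal_def]
  rw [Measure.addHaar_closedBall _ _ (by linarith), Measure.addHaar_ball_of_pos _ _ hh,
    finrank_euclideanSpace_fin, ENNReal.toReal_mul, ENNReal.toReal_mul,
    ENNReal.toReal_ofReal (by positivity), ENNReal.toReal_ofReal (by positivity), mul_pow]
  ring

theorem averages_on_annuli_stmt10 (d : ℕ) (hd : 2 ≤ d)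
    (e : ℝ → ℝ) (hpos : ∀ r > 0, 0 < e r) (hle : ∀ r > 0, e r ≤ r)
    (a : ℝ) (ha : 1 < a)
    (hyp : ∀ δ > (0 : ℝ), ∃ h > (0 : ℝ), ∀ r ∈ Icc h (a * h), e r ≤ δ * r) :
    ¬ ∃ C : ℝ, ∀ g : EuclideanSpace ℝ (Fin d) → ℝ, (∀ x, 0 ≤ g x) →
        Integrable (fun x => g x ^ ((d : ℝ) / ((d : ℝ) - 1))) volume →
        volume {x : EuclideanSpace ℝ (Fin d) | ∃ r > (0 : ℝ), 1 < annulusAvg d e r g x} ≤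
          ENNReal.ofReal (C * ∫ x, g x ^ ((d : ℝ) / ((d : ℝ) - 1))) := by
  rintro ⟨C, hC⟩
  obtain ⟨D, rfl⟩ : ∃ D, d = D + 1 := ⟨d - 1, by omega⟩
  have hD : 1 ≤ D := by omega
  have hD0 : (0 : ℝ) < D := by exact_mod_cast hD
  have ha0 : 0 < a := by linarith
  obtain ⟨p, hp⟩ : ∃ p : ℝ, p = ((D : ℝ) + 1) / D := ⟨_, rfl⟩
  have hpe : (((D + 1 : ℕ) : ℝ) / (((D + 1 : ℕ) : ℝ) - 1)) = p := by
    rw [hp]; push_cast; congr 1; ring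
  rw [hpe] at hC
  have hp1 : 1 < p := by rw [hp, lt_div_iff₀ hD0]; linarith
  obtain ⟨K, hK⟩ : ∃ K : ℝ, K = a ^ D * (3 * ((D + 1 : ℕ) : ℝ) * 6 ^ D) := ⟨_, rfl⟩
  have hK0 : 0 < K := by rw [hK]; positivity
  have main : ∀ n : ℕ, 1 ≤ n → a ^ (D + 1) - 1 ≤ |C| * (4 * K) ^ p * (n : ℝ) ^ (1 - p) := by
    intro n hn
    have hn0 : (0 : ℝ) < n := by exact_mod_cast hn
    obtain ⟨h, hh, hhe⟩ := hyp (1 / (2 ^ n * 3 * a)) (by positivity)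
    have hA : 0 ≤ 2 * K / n := by positivity
    obtain ⟨hI, hB⟩ := testFun_int D hD p hp h (2 * K / n) n hA hh
    have h1 := hC (testFun (D + 1) h (2 * K / n) n) (testFun_nonneg _ _ _ _ hA) hI
    have hsub : annulus (D + 1) (a * h) (a * h - h) ⊆ {x : EuclideanSpace ℝ (Fin (D + 1)) |
        ∃ r > (0 : ℝ), 1 < annulusAvg (D + 1) e r (testFun (D + 1) h (2 * K / n) n) x} := by
      rintro x ⟨hx1, hx2⟩
      have hx3 : h ≤ ‖x‖ := by linarith
      have hx0 : 0 < ‖x‖ := by linarith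
      refine ⟨‖x‖, hx0, ?_⟩
      have he1 := hhe ‖x‖ ⟨hx3, hx2⟩
      have he2 : e ‖x‖ ≤ h / 2 ^ n / 3 := by
        refine he1.trans ((mul_le_mul_of_nonneg_left hx2 (by positivity)).trans (le_of_eq ?_))
        field_simp
      have := testFun_avg (D + 1) e (by omega) a h (2 * K / n) n hA hh ‖x‖ hx3 hx2
        (hpos _ hx0) (hle _ hx0) he2 x rfl
      refine lt_of_lt_of_le ?_ this
      simp only [Nat.add_sub_cancel]
      rw [← hK]
      field_simp
      norm_num
    have hv : 0 < volume.real (ball (0 : EuclideanSpace ℝ (Fin (D + 1))) 1) :=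
      ENNReal.toReal_pos (measure_ball_pos _ _ one_pos).ne' measure_ball_lt_top.ne
    have hJ : 0 ≤ ∫ x, testFun (D + 1) h (2 * K / n) n x ^ p :=
      integral_nonneg fun y => Real.rpow_nonneg (testFun_nonneg _ _ _ _ hA _) _
    have h2 := ENNReal.toReal_mono ENNReal.ofReal_ne_top
      (((measure_mono hsub).trans h1).trans (ENNReal.ofReal_le_ofReal
        (mul_le_mul_of_nonneg_right (le_abs_self C) hJ)))
    rw [ENNReal.toReal_ofReal (mul_nonneg (abs_nonneg _) hJ), ← measureReal_def,
      shell_vol _ a h ha hh] at h2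
    have h3 := h2.trans (mul_le_mul_of_nonneg_left hB (abs_nonneg C))
    have h4 : (2 * (2 * K / n)) ^ p * (n : ℝ) = (4 * K) ^ p * (n : ℝ) ^ (1 - p) := by
      rw [show 2 * (2 * K / n) = 4 * K / n by ring, Real.div_rpow (by positivity) hn0.le,
        Real.rpow_sub hn0, Real.rpow_one]
      ring
    set v := volume.real (ball (0 : EuclideanSpace ℝ (Fin (D + 1))) 1)
    have h5 : 0 < h ^ (D + 1) * v := by positivity
    refine le_of_mul_le_mul_right ?_ h5
    calc _ = (a ^ (D + 1) - 1) * h ^ (D + 1) * v := by ring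
      _ ≤ _ := h3
      _ = |C| * ((2 * (2 * K / n)) ^ p * (n : ℝ)) * (h ^ (D + 1) * v) := by ring
      _ = _ := by rw [h4]; ring
  have hlim : Filter.Tendsto (fun n : ℕ => |C| * (4 * K) ^ p * (n : ℝ) ^ (1 - p))
      Filter.atTop (nhds (|C| * (4 * K) ^ p * 0)) := by
    apply Filter.Tendsto.const_mul
    have := (tendsto_rpow_neg_atTop (y := p - 1) (by linarith)).comp
      (tendsto_natCast_atTop_atTop (R := ℝ))
    simpa [Function.comp_def, neg_sub] using this
  have hfin := ge_of_tendsto hlim (Filter.eventually_atTop.2 ⟨1, main⟩)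
  have : 1 < a ^ (D + 1) := one_lt_pow₀ ha (by omega)
  linarith
end
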